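/- arXiv:1608.05671 — 4 statements merged into one kernel-verified Lean document; each statement's English description precedes it below -/
import Mathlib

section
/- (Ore) Let G = (V, E) be a finite simple graph and let D be a dominating set of G. Then D is a minimal dominating set if and only if for each vertex u ∈ D at least one of the following holds: (i) u is an isolate of D, i.e., N(u) ⊆ V ∖ D; or (ii) there exists a vertex v ∈ V ∖ D such that N[v] ∩ D = {u} (v is a private neighbor of u). -/
/-- `D` is a dominating set of `G`: every vertex not in `D` is adjacent to some vertex of `D`. -/
def IsDomSet {V : Type*} (G : SimpleGraph V) (D : Set V) : Prop :=
  ∀ v ∉ D, ∃ u ∈ D, G.Adj u v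

/-- `D` is a minimal dominating set: it is dominating and no proper subset of it is. -/
def IsMinimalDomSet {V : Type*} (G : SimpleGraph V) (D : Set V) : Prop :=
  IsDomSet G D ∧ ∀ D' : Set V, D' ⊂ D → ¬ IsDomSet G D'

/-- The closed neighborhood `N[u] = N(u) ∪ {u}` of a vertex. -/
def closedNbhd {V : Type*} (G : SimpleGraph V) (u : V) : Set V :=
  insert u (G.neighborSet u)

/-- (Ore) A dominating set `D` of a finite simple graph `G` is a minimal dominating set if and
only if each `u ∈ D` is either an isolate of `D` (i.e. `N(u) ⊆ V ∖ D`) or has a private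
neighbor `v ∈ V ∖ D` with `N[v] ∩ D = {u}`. -/
theorem minimalDomSet_iff_isolate_or_privateNeighbor {V : Type*} [Fintype V]
    (G : SimpleGraph V) (D : Set V) (hD : IsDomSet G D) :
    IsMinimalDomSet G D ↔
      ∀ u ∈ D, G.neighborSet u ⊆ Dᶜ ∨
        ∃ v ∈ Dᶜ, closedNbhd G v ∩ D = {u} := by
  constructor
  · rintro ⟨-, hmin⟩ u hu
    have h := hmin (D \ {u}) (Set.sdiff_singleton_ssubset.2 hu)
    simp only [IsDomSet, not_forall, not_exists, not_and] at h
    obtain ⟨v, hv, hnot⟩ := h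
    have eq_of_adj : ∀ w ∈ D, G.Adj w v → w = u := fun w hw hadj => by
      by_contra hne
      exact hnot w ⟨hw, hne⟩ hadj
    by_cases hvu : v = u
    · subst hvu
      exact .inl fun w hadj hw => hadj.ne (eq_of_adj w hw hadj.symm).symm
    · have hvD : v ∉ D := fun hvD => hv ⟨hvD, hvu⟩
      refine .inr ⟨v, hvD, Set.Subset.antisymm ?_ ?_⟩
      · rintro w ⟨rfl | hadj, hw⟩
        · exact (hvD hw).elim
        · exact eq_of_adj w hw hadj.symm
      · rintro _ rfl
        obtain ⟨w, hw, hadj⟩ := hD v hvD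
        obtain rfl := eq_of_adj w hw hadj
        exact ⟨.inr hadj.symm, hw⟩
  · refine fun h => ⟨hD, fun D' hss hD' => ?_⟩
    obtain ⟨u, hu, huD'⟩ := Set.exists_of_ssubset hss
    rcases h u hu with hiso | ⟨v, hv, hpriv⟩
    · obtain ⟨w, hw, hadj⟩ := hD' u huD'
      exact hiso hadj.symm (hss.subset hw)
    · obtain ⟨w, hw, hadj⟩ := hD' v fun hvD' => hv (hss.subset hvD')
      have hwu : w ∈ ({u} : Set V) := hpriv ▸ ⟨.inr hadj.symm, hss.subset hw⟩
      obtain rfl := Set.mem_singleton_iff.1 hwu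
      exact huD' hw
end

section
/- (Ore) Let G = (V, E) be a finite simple graph with no isolated vertices and let D be a minimal dominating set of G. Then the complement V ∖ D is also a dominating set of G. -/
/-- (Ore) In a finite simple graph with no isolated vertices, the complement of any
minimal dominating set is also a dominating set. -/
theorem compl_of_minimalDomSet_isDomSet {V : Type*} [Fintype V] (G : SimpleGraph V)
    (hiso : ∀ v : V, ∃ w : V, G.Adj v w)
    (D : Set V) (hD : IsMinimalDomSet G D) :
    IsDomSet G Dᶜ := by
  intro v hv
  have hvD : v ∈ D := not_not.mp hv
  by_contra! hnbr
  have mem_of_adj : ∀ u, G.Adj u v → u ∈ D := fun u huv ↦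
    by_contra fun hu ↦ hnbr u hu huv
  refine hD.2 (D \ {v}) (Set.sdiff_singleton_ssubset.mpr hvD) fun x hx ↦ ?_
  by_cases hxD : x ∈ D
  · obtain rfl : x = v := by_contra fun hxv ↦ hx ⟨hxD, hxv⟩
    obtain ⟨w, hw⟩ := hiso x
    exact ⟨w, ⟨mem_of_adj w hw.symm, hw.ne'⟩, hw.symm⟩
  · obtain ⟨u, huD, hux⟩ := hD.1 x hxD
    refine ⟨u, ⟨huD, ?_⟩, hux⟩
    rintro rfl
    exact hxD (mem_of_adj x hux.symm)
end

section
/- (Ore) Let G = (V, E) be a finite simple graph with no isolated vertices and |V| = n ≥ 1. Then γ(G) ≤ n/2. -/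
/-- The domination number `γ(G)`: the minimum cardinality of a dominating set of `G`. -/
noncomputable def domNumber {V : Type*} [Fintype V] (G : SimpleGraph V) : ℕ :=
  sInf {n : ℕ | ∃ D : Set V, IsDomSet G D ∧ D.ncard = n}

/-- The complement of a minimal dominating set is dominating if there are no isolated vertices. -/
theorem IsDomSet.compl_of_minimal {V : Type*} {G : SimpleGraph V} {D : Set V}
    (hiso : ∀ v : V, ∃ w : V, G.Adj v w) (hD : Minimal (IsDomSet G) D) : IsDomSet G Dᶜ := by
  intro v hv
  rw [Set.notMem_compl_iff] at hv
  by_contra! h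
  have hdom : IsDomSet G (D \ {v}) := by
    intro x hx
    by_cases hxv : x = v
    · subst hxv
      obtain ⟨w, hw⟩ := hiso x
      exact ⟨w, ⟨by_contra fun hwD => h w hwD hw.symm, hw.ne'⟩, hw.symm⟩
    · have hxD : x ∉ D := fun hxD => hx ⟨hxD, hxv⟩
      obtain ⟨u, hu, hux⟩ := hD.prop x hxD
      refine ⟨u, ⟨hu, ?_⟩, hux⟩
      rintro rfl
      exact h x hxD hux.symm
  exact (hD.le_of_le hdom Set.sdiff_subset hv).2 rfl

theorem domNumber_le_ncard {V : Type*} [Fintype V] {G : SimpleGraph V} {D : Set V}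
    (hD : IsDomSet G D) : domNumber G ≤ D.ncard :=
  Nat.sInf_le ⟨D, hD, rfl⟩

/-- (Ore) If `G` is a finite simple graph with no isolated vertices and `n = |V| ≥ 1`
vertices, then `γ(G) ≤ n / 2`. -/
theorem domNumber_le_half_card {V : Type*} [Fintype V] (G : SimpleGraph V)
    (hn : 1 ≤ Fintype.card V) (hiso : ∀ v : V, ∃ w : V, G.Adj v w) :
    (domNumber G : ℝ) ≤ (Fintype.card V : ℝ) / 2 := by
  have huniv : IsDomSet G Set.univ := fun v hv => absurd (Set.mem_univ v) hv
  obtain ⟨D, -, hD⟩ := exists_minimal_le_of_wellFoundedLT (IsDomSet G) Set.univ huniv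
  have h₁ := domNumber_le_ncard hD.prop
  have h₂ := domNumber_le_ncard (IsDomSet.compl_of_minimal hiso hD)
  have h₃ := Set.ncard_add_ncard_compl D
  rw [Nat.card_eq_fintype_card] at h₃
  have h₄ : (domNumber G : ℝ) * 2 ≤ Fintype.card V := by
    exact_mod_cast (by lia : domNumber G * 2 ≤ Fintype.card V)
  linarith
end

section
/- Let G = (V, E) be a finite simple graph and let D be a minimum dominating set of G. Then G is the disjoint union of the ego-centered subgraphs {G(N[u])}_{u ∈ D} — that is, the closed neighborhoods N[u], u ∈ D, are pairwise disjoint and every edge of G has both of its endpoints in N[u] for some u ∈ D — if and only if V_public(D) = ∅, E_ego(D) = ∅, E_public(D) = ∅ and E_private-public(D) = ∅. -/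
/-- `D` is a minimum dominating set: a dominating set of cardinality `γ(G)`. -/
def IsMinDomSet {V : Type*} [Fintype V] (G : SimpleGraph V) (D : Set V) : Prop :=
  IsDomSet G D ∧ D.ncard = domNumber G

/-- The private alters of a dominating set `D`: vertices `w ∉ D` having some ego `u ∈ D`
with `w ∈ N(u)` and `N(w) ⊆ N[u]`. -/
def privateAlters {V : Type*} (G : SimpleGraph V) (D : Set V) : Set V :=
  {w : V | w ∉ D ∧ ∃ u ∈ D, w ∈ G.neighborSet u ∧ G.neighborSet w ⊆ closedNbhd G u}

/-- The public alters of a dominating set `D`: the vertices outside `D` that are not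
private alters. -/
def publicAlters {V : Type*} (G : SimpleGraph V) (D : Set V) : Set V :=
  Dᶜ \ privateAlters G D

/-- The edges of `G` with both endpoints in the vertex set `A`. -/
def edgesWithin {V : Type*} (G : SimpleGraph V) (A : Set V) : Set (Sym2 V) :=
  {e ∈ G.edgeSet | ∀ v ∈ e, v ∈ A}

/-- The edges of `G` with one endpoint in `A` and the other in `B`. -/
def edgesBetween {V : Type*} (G : SimpleGraph V) (A B : Set V) : Set (Sym2 V) :=
  {e : Sym2 V | ∃ v w, e = s(v, w) ∧ G.Adj v w ∧ v ∈ A ∧ w ∈ B}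

/-- For a minimum dominating set `D` of a finite simple graph `G`, the graph `G` is the
disjoint union of the ego-centered subgraphs `{G(N[u])}_{u ∈ D}` — i.e., the closed
neighborhoods `N[u]`, `u ∈ D`, are pairwise disjoint and every edge of `G` lies within some
`N[u]` — if and only if `V_public(D) = ∅`, `E_ego(D) = ∅`, `E_public(D) = ∅` and
`E_private-public(D) = ∅`. -/
theorem disjoint_union_iff {V : Type*} [Fintype V] (G : SimpleGraph V)
    (D : Set V) (hD : IsMinDomSet G D) :
    ((∀ u₁ ∈ D, ∀ u₂ ∈ D, u₁ ≠ u₂ → Disjoint (closedNbhd G u₁) (closedNbhd G u₂)) ∧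
      (∀ v w : V, G.Adj v w → ∃ u ∈ D, v ∈ closedNbhd G u ∧ w ∈ closedNbhd G u)) ↔
    (publicAlters G D = ∅ ∧ edgesWithin G D = ∅ ∧
      edgesWithin G (publicAlters G D) = ∅ ∧
      edgesBetween G (privateAlters G D) (publicAlters G D) = ∅) := by
  constructor
  · rintro ⟨hdisj, hedge⟩
    have heq : ∀ u₁ ∈ D, ∀ u₂ ∈ D, ∀ x, x ∈ closedNbhd G u₁ → x ∈ closedNbhd G u₂ → u₁ = u₂ := by
      intro u₁ h₁ u₂ h₂ x hx₁ hx₂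
      by_contra hne
      exact Set.disjoint_left.mp (hdisj u₁ h₁ u₂ h₂ hne) hx₁ hx₂
    have hpub : publicAlters G D = ∅ := by
      rw [publicAlters, Set.sdiff_eq_empty]
      intro w hw
      obtain ⟨u, hu, huw⟩ := hD.1 w hw
      refine ⟨hw, u, hu, huw, fun x hx => ?_⟩
      obtain ⟨u', hu', hwu', hxu'⟩ := hedge w x hx
      rwa [heq u hu u' hu' w (Or.inr huw) hwu']
    refine ⟨hpub, ?_, ?_, ?_⟩
    · refine Set.eq_empty_of_forall_notMem fun e => ?_
      induction e with
      | _ v w =>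
        rintro ⟨hadj, hmem⟩
        have hvw : G.Adj v w := hadj
        exact hvw.ne (heq v (hmem v (by simp)) w (hmem w (by simp)) w (Or.inr hvw) (Or.inl rfl))
    · refine Set.eq_empty_of_forall_notMem fun e => ?_
      induction e with
      | _ v w =>
        rintro ⟨-, hmem⟩
        simpa [hpub] using hmem v (by simp)
    · simp [edgesBetween, hpub]
  · rintro ⟨hpub, hego, -, -⟩
    have hpriv : ∀ w ∉ D, w ∈ privateAlters G D := fun w hw =>
      Set.sdiff_eq_empty.mp hpub hw
    have hindep : ∀ u ∈ D, ∀ v ∈ D, v ∈ closedNbhd G u → v = u := by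
      rintro u hu v hv (rfl | hadj)
      · rfl
      · have : s(u, v) ∈ edgesWithin G D := ⟨hadj, by simp [hu, hv]⟩
        simp [hego] at this
    refine ⟨fun u₁ h₁ u₂ h₂ hne => Set.disjoint_left.mpr fun w hw₁ hw₂ => hne ?_, fun v w hvw => ?_⟩
    · by_cases hw : w ∈ D
      · rw [← hindep u₁ h₁ w hw hw₁, ← hindep u₂ h₂ w hw hw₂]
      · obtain ⟨-, u, hu, -, hsub⟩ := hpriv w hw
        have huniq : ∀ v ∈ D, w ∈ closedNbhd G v → v = u := by
          rintro v hv (rfl | hadj)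
          · exact absurd hv hw
          · exact hindep u hu v hv (hsub (SimpleGraph.Adj.symm hadj))
        rw [huniq u₁ h₁ hw₁, huniq u₂ h₂ hw₂]
    · by_cases hv : v ∈ D
      · exact ⟨v, hv, Or.inl rfl, Or.inr hvw⟩
      · obtain ⟨-, u, hu, huv, hsub⟩ := hpriv v hv
        exact ⟨u, hu, Or.inr huv, hsub hvw⟩
end
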